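/- arXiv:1707.07293 — 3 statements merged into one kernel-verified Lean document; each statement's English description precedes it below -/
import Mathlib

section
/- Let G be a finite group with α(G) ≥ 5/6. Then exactly one of the following holds: G ≅ C₂ⁿ × S₃ for some n ≥ 0 and α(G) = 5/6; or G ≅ C₂ⁿ × D₈ for some n ≥ 0 and α(G) = 7/8; or G ≅ C₂ⁿ for some n ≥ 0 and α(G) = 1. -/
open scoped Classical

/-- The number of cyclic subgroups of a group. -/
noncomputable def numCyclic (G : Type*) [Group G] : ℕ :=
  Nat.card {H : Subgroup G // IsCyclic (↥H)}

/-- `alpha G = c(G) / |G|`, the number of cyclic subgroups divided by the order. -/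
noncomputable def alpha (G : Type*) [Group G] : ℚ :=
  (numCyclic G : ℚ) / (Nat.card G : ℚ)

/-- The number of solutions of `g * g = 1` in a group. -/
noncomputable def numSqOne (G : Type*) [Group G] : ℕ :=
  {g : G | g * g = 1}.ncard

theorem numSqOne_congr {G H : Type*} [Group G] [Group H] (e : G ≃* H) :
    numSqOne G = numSqOne H := by
  unfold numSqOne
  rw [← Set.ncard_image_of_injective _ e.injective]
  congr 1
  ext h
  simp only [Set.mem_image, Set.mem_ofPred_eq]
  constructor
  · rintro ⟨g, hg, rfl⟩
    rw [← map_mul, hg, map_one]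
  · intro hh
    exact ⟨e.symm h, by rw [← map_mul, hh, map_one], by simp⟩

theorem numSqOne_prod (G H : Type*) [Group G] [Group H] :
    numSqOne (G × H) = numSqOne G * numSqOne H := by
  unfold numSqOne
  rw [← Set.ncard_prod]
  congr 1
  ext ⟨a, b⟩
  simp [Prod.ext_iff]

theorem numSqOne_of_forall {G : Type*} [Group G] (h : ∀ g : G, g * g = 1) :
    numSqOne G = Nat.card G := by
  unfold numSqOne
  rw [← Set.ncard_univ]
  congr 1
  ext g
  simp [h]

theorem numSqOne_dihedral_three : numSqOne (DihedralGroup 3) = 4 := by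
  unfold numSqOne
  rw [Set.ncard_eq_toFinset_card']
  decide

theorem numSqOne_dihedral_four : numSqOne (DihedralGroup 4) = 6 := by
  unfold numSqOne
  rw [Set.ncard_eq_toFinset_card']
  decide

theorem numCyclic_eq_card_image (G : Type*) [Group G] [Fintype G] :
    numCyclic G = (Finset.univ.image (Subgroup.zpowers : G → Subgroup G)).card := by
  have h : {H : Subgroup G | IsCyclic H} =
      ↑(Finset.univ.image (Subgroup.zpowers : G → Subgroup G)) := by
    ext H
    simp [Subgroup.isCyclic_iff_exists_zpowers_eq_top]
  rw [← Set.ncard_coe_finset, ← h]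
  rfl

/-- The order of `G` plus the number of solutions of `g * g = 1`, counted along the fibres of
`Subgroup.zpowers`. -/
theorem card_add_numSqOne (G : Type*) [Group G] [Fintype G] :
    Nat.card G + numSqOne G = ∑ H ∈ Finset.univ.image (Subgroup.zpowers : G → Subgroup G),
      ((Finset.univ.filter fun g : G => Subgroup.zpowers g = H).card +
        (Finset.univ.filter fun g : G => g * g = 1 ∧ Subgroup.zpowers g = H).card) := by
  rw [Finset.sum_add_distrib]
  congr 1
  · rw [Nat.card_eq_fintype_card, ← Finset.card_univ]
    exact Finset.card_eq_sum_card_image _ _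
  · unfold numSqOne
    rw [Set.ncard_eq_toFinset_card']
    rw [Finset.card_eq_sum_card_fiberwise (f := (Subgroup.zpowers : G → Subgroup G))
      (t := Finset.univ.image (Subgroup.zpowers : G → Subgroup G))]
    · refine Finset.sum_congr rfl fun H _ => ?_
      congr 1
      ext g
      simp
    · intro g _
      simp

theorem two_mul_numCyclic_le (G : Type*) [Group G] [Fintype G] :
    2 * numCyclic G ≤ Nat.card G + numSqOne G := by
  rw [card_add_numSqOne, numCyclic_eq_card_image, mul_comm, ← smul_eq_mul]
  refine Finset.card_nsmul_le_sum _ _ _ fun H hH => ?_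
  obtain ⟨g, -, rfl⟩ := Finset.mem_image.mp hH
  by_cases hg : g * g = 1
  · have h1 : 0 < (Finset.univ.filter fun k : G =>
        Subgroup.zpowers k = Subgroup.zpowers g).card :=
      Finset.card_pos.mpr ⟨g, by simp⟩
    have h2 : 0 < (Finset.univ.filter fun k : G =>
        k * k = 1 ∧ Subgroup.zpowers k = Subgroup.zpowers g).card :=
      Finset.card_pos.mpr ⟨g, by simp [hg]⟩
    omega
  · have h1 : 1 < (Finset.univ.filter fun k : G =>
        Subgroup.zpowers k = Subgroup.zpowers g).card :=
      Finset.one_lt_card.mpr ⟨g, by simp, g⁻¹, by simp, fun h => hg (mul_eq_one_iff_eq_inv.mpr h)⟩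
    omega

theorem two_mul_numCyclic (G : Type*) [Group G] [Fintype G]
    (hG : ∀ g h : G, Subgroup.zpowers h = Subgroup.zpowers g → h = g ∨ h = g⁻¹) :
    2 * numCyclic G = Nat.card G + numSqOne G := by
  refine le_antisymm (two_mul_numCyclic_le G) ?_
  rw [card_add_numSqOne, numCyclic_eq_card_image, mul_comm, ← smul_eq_mul]
  refine Finset.sum_le_card_nsmul _ _ _ fun H hH => ?_
  obtain ⟨g, -, rfl⟩ := Finset.mem_image.mp hH
  by_cases hg : g * g = 1
  · have hg' : g⁻¹ = g := (mul_eq_one_iff_eq_inv.mp hg).symm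
    have key : ∀ k : G, Subgroup.zpowers k = Subgroup.zpowers g → k = g := fun k hk => by
      rcases hG g k hk with h | h
      · exact h
      · rw [h, hg']
    have h1 : (Finset.univ.filter fun k : G =>
        Subgroup.zpowers k = Subgroup.zpowers g).card ≤ 1 := by
      rw [← Finset.card_singleton g]
      refine Finset.card_le_card fun k hk => ?_
      simpa using key k (by simpa using hk)
    have h2 : (Finset.univ.filter fun k : G =>
        k * k = 1 ∧ Subgroup.zpowers k = Subgroup.zpowers g).card ≤ 1 := by
      rw [← Finset.card_singleton g]
      refine Finset.card_le_card fun k hk => ?_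
      simpa using key k (Finset.mem_filter.mp hk).2.2
    omega
  · have h1 : (Finset.univ.filter fun k : G =>
        Subgroup.zpowers k = Subgroup.zpowers g).card ≤ 2 := by
      refine le_trans (Finset.card_le_card fun k hk => ?_) (Finset.card_le_two (a := g) (b := g⁻¹))
      simpa using hG g k (by simpa using hk)
    have h2 : (Finset.univ.filter fun k : G =>
        k * k = 1 ∧ Subgroup.zpowers k = Subgroup.zpowers g) = ∅ := by
      refine Finset.filter_eq_empty_iff.mpr fun k _ hk => hg ?_
      rcases hG g k hk.2 with h | h
      · rw [← h]; exact hk.1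
      · have := hk.1
        rw [h, ← mul_inv_rev, inv_eq_one] at this
        exact this
    rw [h2, Finset.card_empty]
    omega

theorem eq_or_eq_inv_of_zpowers_eq {G : Type*} [Group G] {g h : G} (hg : g ^ 4 = 1)
    (e : Subgroup.zpowers h = Subgroup.zpowers g) : h = g ∨ h = g⁻¹ := by
  have h1 : h ∈ Subgroup.zpowers g := e ▸ Subgroup.mem_zpowers h
  obtain ⟨k, rfl⟩ := Subgroup.mem_zpowers_iff.mp h1
  have h2 : g ∈ Subgroup.zpowers (g ^ k) := e ▸ Subgroup.mem_zpowers g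
  obtain ⟨m, hm⟩ := Subgroup.mem_zpowers_iff.mp h2
  have h4 : ∀ a b : ℤ, a % 4 = b % 4 → g ^ a = g ^ b := fun a b hab => by
    rw [← Int.mul_ediv_add_emod a 4, ← Int.mul_ediv_add_emod b 4, hab]
    have : g ^ (4 : ℤ) = 1 := by exact_mod_cast hg
    simp [zpow_add, zpow_mul, this]
  have hcases : k % 4 = 0 ∨ k % 4 = 1 ∨ k % 4 = 2 ∨ k % 4 = 3 := by omega
  rcases hcases with hk | hk | hk | hk
  · left
    have : g ^ k = 1 := by simpa using h4 k 0 (by omega)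
    rw [this, one_zpow] at hm
    rw [this, hm]
  · left; simpa using h4 k 1 (by omega)
  · left
    have hk2 : g ^ k = g ^ (2 : ℤ) := h4 k 2 (by omega)
    rcases Int.even_or_odd m with ⟨j, hj⟩ | ⟨j, hj⟩
    · have : g = 1 := by
        rw [← hm, ← zpow_mul]
        simpa using h4 (k * m) 0 (by rw [Int.mul_emod, hk, hj]; omega)
      rw [this]; simp
    · conv_rhs => rw [← hm, ← zpow_mul]
      refine h4 _ _ ?_
      rw [Int.mul_emod, hk, hj]; omega
  · right; simpa using h4 k (-1) (by omega)

theorem mul_comm_of_mul_self_eq_one {G : Type*} [Group G] (h : ∀ g : G, g * g = 1) (a b : G) :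
    a * b = b * a := by
  have hinv : ∀ g : G, g⁻¹ = g := fun g => (mul_eq_one_iff_eq_inv.mp (h g)).symm
  rw [← hinv (a * b), mul_inv_rev, hinv, hinv]

theorem exists_mulEquiv_pi_of_mul_self_eq_one {G : Type*} [Group G] [Finite G]
    (h : ∀ g : G, g * g = 1) : ∃ n : ℕ, Nonempty (G ≃* (Fin n → Multiplicative (ZMod 2))) := by
  let _ : CommGroup G := { ‹Group G› with mul_comm := mul_comm_of_mul_self_eq_one h }
  let _ : Module (ZMod 2) (Additive G) :=
    AddCommGroup.zmodModule (n := 2) fun x => by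
      rw [two_nsmul]
      exact h x.toMul
  have : Module.Finite (ZMod 2) (Additive G) := Module.Finite.of_finite
  let e := (Module.finBasis (ZMod 2) (Additive G)).equivFun
  exact ⟨_, ⟨{ toFun := fun g i => Multiplicative.ofAdd (e (Additive.ofMul g) i)
               invFun := fun f => (e.symm fun i => (f i).toAdd).toMul
               left_inv := fun g => by simp
               right_inv := fun f => by simp
               map_mul' := fun a b => by ext i; simp }⟩⟩

theorem mul_self_pi_zmod_two {n : ℕ} (f : Fin n → Multiplicative (ZMod 2)) : f * f = 1 := by
  funext i
  exact congrArg Multiplicative.ofAdd (CharTwo.add_self_eq_zero (f i).toAdd)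

theorem mul_pow_mul_self_eq_one {G : Type*} [Group G] {x y : G} (hx : x * x = 1) (hy : y * y = 1)
    (k : ℤ) : x * (x * y) ^ k = (x * y) ^ (-k) * x := by
  have hxi : x⁻¹ = x := (mul_eq_one_iff_eq_inv.mp hx).symm
  have hyi : y⁻¹ = y := (mul_eq_one_iff_eq_inv.mp hy).symm
  have h1 : x * (x * y) * x⁻¹ = (x * y)⁻¹ := by
    rw [mul_inv_rev, hxi, hyi, ← mul_assoc, hx, one_mul]
  have h2 : x * (x * y) ^ k * x⁻¹ = (x * y) ^ (-k) := by
    rw [← conj_zpow, h1, inv_zpow, zpow_neg]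
  rw [← h2, inv_mul_cancel_right]

section Dihedral

variable {G : Type*} [Group G] {n : ℕ} {x y : G}

/-- The powers of `a`, indexed by `ZMod n`, when `a ^ n = 1`. -/
noncomputable def zmodPow (a : G) (ha : a ^ n = 1) : ZMod n →+ Additive G :=
  ZMod.lift n ⟨zmultiplesHom (Additive G) (Additive.ofMul a), by
    simp only [zmultiplesHom_apply, natCast_zsmul, ← ofMul_pow, ha, ofMul_one]⟩

theorem zmodPow_intCast (a : G) (ha : a ^ n = 1) (k : ℤ) :
    (zmodPow a ha (k : ZMod n)).toMul = a ^ k := by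
  simp [zmodPow]

/-- The homomorphism from a dihedral group given by two involutions `x`, `y`
with `(x * y) ^ n = 1`. -/
noncomputable def dihedralHom (hx : x * x = 1) (hy : y * y = 1) (ha : (x * y) ^ n = 1) :
    DihedralGroup n →* G :=
  MonoidHom.mk'
    (fun d => match d with
      | .r i => (zmodPow (x * y) ha i).toMul
      | .sr i => x * (zmodPow (x * y) ha i).toMul)
    (by
      have hswap : ∀ k : ℤ, (x * y) ^ k * x = x * (x * y) ^ (-k) := fun k => by
        rw [mul_pow_mul_self_eq_one hx hy, neg_neg]
      rintro (i | i) (j | j) <;> obtain ⟨i, rfl⟩ := ZMod.intCast_surjective i <;>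
        obtain ⟨j, rfl⟩ := ZMod.intCast_surjective j <;>
        simp only [DihedralGroup.r_mul_r, DihedralGroup.r_mul_sr, DihedralGroup.sr_mul_r,
          DihedralGroup.sr_mul_sr, ← Int.cast_add, ← Int.cast_sub, zmodPow_intCast]
      · rw [zpow_add]
      · rw [← mul_assoc, hswap, mul_assoc, ← zpow_add, neg_add_eq_sub]
      · rw [zpow_add, mul_assoc]
      · rw [mul_assoc, ← mul_assoc _ x, hswap, mul_assoc, ← zpow_add, ← mul_assoc, hx, one_mul,
          neg_add_eq_sub])

theorem dihedralHom_r_intCast (hx : x * x = 1) (hy : y * y = 1) (ha : (x * y) ^ n = 1) (k : ℤ) :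
    dihedralHom hx hy ha (.r (k : ZMod n)) = (x * y) ^ k :=
  zmodPow_intCast _ ha k

theorem dihedralHom_sr_intCast (hx : x * x = 1) (hy : y * y = 1) (ha : (x * y) ^ n = 1) (k : ℤ) :
    dihedralHom hx hy ha (.sr (k : ZMod n)) = x * (x * y) ^ k :=
  congrArg (x * ·) (zmodPow_intCast _ ha k)

theorem left_mem_range_dihedralHom (hx : x * x = 1) (hy : y * y = 1) (ha : (x * y) ^ n = 1) :
    x ∈ (dihedralHom hx hy ha).range :=
  ⟨.sr ((0 : ℤ) : ZMod n), by rw [dihedralHom_sr_intCast, zpow_zero, mul_one]⟩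

theorem right_mem_range_dihedralHom (hx : x * x = 1) (hy : y * y = 1) (ha : (x * y) ^ n = 1) :
    y ∈ (dihedralHom hx hy ha).range :=
  ⟨.sr ((1 : ℤ) : ZMod n), by
    rw [dihedralHom_sr_intCast, zpow_one, ← mul_assoc, hx, one_mul]⟩

/-- A group generated by an elementary abelian 2-group `V` and a dihedral group centralizing it,
of the largest possible order, is their direct product. -/
theorem exists_mulEquiv_pi_prod_dihedral [Finite G] [NeZero n] (V : Subgroup G)
    (hV : ∀ v ∈ V, v * v = 1) (hVx : ∀ v ∈ V, v * x = x * v) (hVy : ∀ v ∈ V, v * y = y * v)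
    (hx : x * x = 1) (hy : y * y = 1) (ha : (x * y) ^ n = 1)
    (hcard : Nat.card G = Nat.card V * (2 * n))
    (hgen : ∀ R : Subgroup G, V ≤ R → x ∈ R → y ∈ R → R = ⊤) :
    ∃ m : ℕ, Nonempty (G ≃* (Fin m → Multiplicative (ZMod 2)) × DihedralGroup n) := by
  have hcomm : ∀ (v : V) (d : DihedralGroup n), Commute (V.subtype v) (dihedralHom hx hy ha d) := by
    rintro ⟨v, hv⟩ d
    have hvx : Commute v x := hVx v hv
    have hvxy : Commute v (x * y) := hvx.mul_right (hVy v hv)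
    rcases d with i | i <;> obtain ⟨i, rfl⟩ := ZMod.intCast_surjective i
    · rw [dihedralHom_r_intCast]
      exact hvxy.zpow_right i
    · rw [dihedralHom_sr_intCast]
      exact hvx.mul_right (hvxy.zpow_right i)
  let f : V × DihedralGroup n →* G := V.subtype.noncommCoprod (dihedralHom hx hy ha) hcomm
  have hrange : f.range = ⊤ := by
    refine hgen _ (fun v hv => ⟨(⟨v, hv⟩, 1), by simp [f]⟩) ?_ ?_
    · obtain ⟨d, hd⟩ := left_mem_range_dihedralHom hx hy ha
      exact ⟨(1, d), by simp [f, hd]⟩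
    · obtain ⟨d, hd⟩ := right_mem_range_dihedralHom hx hy ha
      exact ⟨(1, d), by simp [f, hd]⟩
  have hbij : Function.Bijective f := by
    refine (Nat.bijective_iff_surjective_and_card _).mpr ⟨MonoidHom.range_eq_top.mp hrange, ?_⟩
    rw [Nat.card_prod, DihedralGroup.nat_card, hcard]
  obtain ⟨m, ⟨e⟩⟩ := exists_mulEquiv_pi_of_mul_self_eq_one (G := V) fun v =>
    Subtype.ext (hV v v.2)
  exact ⟨m, ⟨(MulEquiv.ofBijective f hbij).symm.trans (e.prodCongr (MulEquiv.refl _))⟩⟩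

end Dihedral

theorem nonempty_dihedral_three_mulEquiv_perm :
    Nonempty (DihedralGroup 3 ≃* Equiv.Perm (Fin 3)) := by
  let x : Equiv.Perm (Fin 3) := Equiv.swap 0 1
  let y : Equiv.Perm (Fin 3) := Equiv.swap 1 2
  have hx : x * x = 1 := by decide
  have hy : y * y = 1 := by decide
  have ha : (x * y) ^ 3 = 1 := by decide
  refine ⟨MulEquiv.ofBijective (dihedralHom hx hy ha) ?_⟩
  refine (Nat.bijective_iff_surjective_and_card _).mpr ⟨fun p => ?_, ?_⟩
  · have key : ∀ p : Equiv.Perm (Fin 3),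
        ∃ k : Fin 3, p = (x * y) ^ (k : ℕ) ∨ p = x * (x * y) ^ (k : ℕ) := by decide
    obtain ⟨k, rfl | rfl⟩ := key p
    · exact ⟨.r (((k : ℕ) : ℤ) : ZMod 3), by rw [dihedralHom_r_intCast, zpow_natCast]⟩
    · exact ⟨.sr (((k : ℕ) : ℤ) : ZMod 3), by rw [dihedralHom_sr_intCast, zpow_natCast]⟩
  · rw [DihedralGroup.nat_card, Nat.card_eq_fintype_card, Fintype.card_perm, Fintype.card_fin]
    rfl

theorem alpha_eq_of_two_mul_numCyclic {G : Type*} [Group G] [Finite G] {q : ℚ}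
    (h : 2 * numCyclic G = Nat.card G + numSqOne G) (hq : (numSqOne G : ℚ) = q * Nat.card G) :
    alpha G = (1 + q) / 2 := by
  have hG : (Nat.card G : ℚ) ≠ 0 := by exact_mod_cast Nat.card_pos.ne'
  have h' : (2 : ℚ) * numCyclic G = Nat.card G + numSqOne G := by exact_mod_cast h
  unfold alpha
  rw [div_eq_iff hG]
  linarith

theorem alpha_le {G : Type*} [Group G] [Fintype G] {q : ℚ}
    (hq : (numSqOne G : ℚ) ≤ q * Nat.card G) : alpha G ≤ (1 + q) / 2 := by
  have hG : (0 : ℚ) < Nat.card G := by exact_mod_cast Nat.card_pos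
  have h' : (2 : ℚ) * numCyclic G ≤ Nat.card G + numSqOne G := by
    exact_mod_cast two_mul_numCyclic_le G
  unfold alpha
  rw [div_le_iff₀ hG]
  linarith

theorem numSqOne_of_mulEquiv_prod {G H : Type*} [Group G] [Group H] {n : ℕ}
    (e : G ≃* (Fin n → Multiplicative (ZMod 2)) × H) :
    numSqOne G * Nat.card H = numSqOne H * Nat.card G := by
  rw [numSqOne_congr e, Nat.card_congr e.toEquiv, numSqOne_prod, Nat.card_prod,
    numSqOne_of_forall mul_self_pi_zmod_two]
  ring

theorem alpha_of_forall_mul_self {G : Type*} [Group G] [Fintype G] (h : ∀ g : G, g * g = 1) :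
    alpha G = 1 := by
  have hc := two_mul_numCyclic G fun g k => eq_or_eq_inv_of_zpowers_eq (by
    rw [show 4 = 2 * 2 from rfl, pow_mul, pow_two g, h, one_pow])
  rw [alpha_eq_of_two_mul_numCyclic (q := 1) hc (by rw [numSqOne_of_forall h, one_mul])]
  norm_num

theorem alpha_le_of_mulEquiv_dihedral_three {G : Type*} [Group G] [Fintype G] {n : ℕ}
    (e : G ≃* (Fin n → Multiplicative (ZMod 2)) × DihedralGroup 3) : alpha G ≤ 5 / 6 := by
  have h := numSqOne_of_mulEquiv_prod e
  rw [DihedralGroup.nat_card, numSqOne_dihedral_three] at h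
  have h' : (numSqOne G : ℚ) * (2 * 3) = 4 * Nat.card G := by exact_mod_cast h
  refine (alpha_le (q := 2 / 3) (by linarith)).trans (by norm_num)

theorem alpha_of_mulEquiv_dihedral_four {G : Type*} [Group G] [Fintype G] {n : ℕ}
    (e : G ≃* (Fin n → Multiplicative (ZMod 2)) × DihedralGroup 4) : alpha G = 7 / 8 := by
  have h := numSqOne_of_mulEquiv_prod e
  rw [DihedralGroup.nat_card, numSqOne_dihedral_four] at h
  have h' : (numSqOne G : ℚ) * (2 * 4) = 6 * Nat.card G := by exact_mod_cast h
  have hpow : ∀ g : G, g ^ 4 = 1 := fun g => by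
    apply e.injective
    rw [map_pow, map_one]
    refine Prod.ext ?_ ?_
    · rw [Prod.pow_fst, pow_mul (e g).1 2 2, pow_two (e g).1, mul_self_pi_zmod_two,
        one_pow, Prod.fst_one]
    · have : ∀ d : DihedralGroup 4, d ^ 4 = 1 := by decide
      exact this _
  rw [alpha_eq_of_two_mul_numCyclic (q := 3 / 4)
    (two_mul_numCyclic G fun g k => eq_or_eq_inv_of_zpowers_eq (hpow g)) (by linarith)]
  norm_num

section Involutions

variable {G : Type*} [Group G]

theorem eq_top_of_prime_index {p : ℕ} (hp : p.Prime) {H R : Subgroup G} (hH : H.index = p)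
    (hHR : H ≤ R) {y : G} (hyR : y ∈ R) (hyH : y ∉ H) : R = ⊤ := by
  have h := Subgroup.relIndex_mul_index hHR
  rw [hH] at h
  rcases (Nat.dvd_prime hp).mp (Dvd.intro_left _ h) with h1 | h1
  · exact Subgroup.index_eq_one.mp h1
  · have h2 : H.relIndex R = 1 := by
      rw [h1] at h
      exact Nat.eq_of_mul_eq_mul_right hp.pos (by rw [h, one_mul])
    exact absurd (Subgroup.relIndex_eq_one.mp h2 hyR) hyH

theorem mem_or_mul_mem_of_relIndex_eq_two {H K : Subgroup G} (h : H.relIndex K = 2) {x : G}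
    (hxK : x ∈ K) (hxH : x ∉ H) {g : G} (hg : g ∈ K) : g ∈ H ∨ x * g ∈ H := by
  by_contra! hn
  have key := Subgroup.mul_mem_iff_of_index_two (H := H.subgroupOf K) h (a := ⟨x, hxK⟩)
    (b := ⟨g, hg⟩)
  simp only [Subgroup.mem_subgroupOf] at key
  exact hn.2 (key.mpr ⟨fun h => absurd h hxH, fun h => absurd h hn.1⟩)

/-- If the centralizer of `x` has prime index and `y` lies outside it, with the common centralizer of
`x` and `y` of index two in that of `x`, then `x`, `y` and this common centralizer generate. -/
theorem eq_top_of_centralizer_inf_le {p : ℕ} (hp : p.Prime) {x y : G}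
    (hind : (Subgroup.centralizer {x}).index = p) (hy : y ∉ Subgroup.centralizer {x})
    (hrel : (Subgroup.centralizer {y}).relIndex (Subgroup.centralizer {x}) = 2)
    {R : Subgroup G} (hR : Subgroup.centralizer {x} ⊓ Subgroup.centralizer {y} ≤ R)
    (hxR : x ∈ R) (hyR : y ∈ R) : R = ⊤ := by
  have hxx : x ∈ Subgroup.centralizer {x} := Subgroup.mem_centralizer_singleton_iff.mpr rfl
  have hxy : x ∉ Subgroup.centralizer {y} := fun h =>
    hy (Subgroup.mem_centralizer_singleton_iff.mpr
      (Subgroup.mem_centralizer_singleton_iff.mp h).symm)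
  refine eq_top_of_prime_index hp hind (fun g hg => ?_) hyR hy
  rcases mem_or_mul_mem_of_relIndex_eq_two hrel hxx hxy hg with h | h
  · exact hR ⟨hg, h⟩
  · exact (R.mul_mem_cancel_left hxR).mp (hR ⟨mul_mem hxx hg, h⟩)

theorem card_eq_card_centralizer_inf_mul {p : ℕ} {x y : G}
    (hind : (Subgroup.centralizer {x}).index = p)
    (hrel : (Subgroup.centralizer {y}).relIndex (Subgroup.centralizer {x}) = 2) :
    Nat.card G =
      Nat.card (Subgroup.centralizer {x} ⊓ Subgroup.centralizer {y} : Subgroup G) * (2 * p) := by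
  rw [← hrel, ← hind, ← Subgroup.inf_relIndex_left, Subgroup.relIndex_mul_index inf_le_left,
    Subgroup.card_mul_index]

theorem inter_image_mul_subset {x : G} (hx : x * x = 1) :
    {g : G | g * g = 1} ∩ (x * ·) '' {g : G | g * g = 1} ⊆
      {g : G | g * g = 1} ∩ Subgroup.centralizer {x} := by
  rintro _ ⟨hg, g, hg', rfl⟩
  refine ⟨hg, ?_⟩
  simp only [Set.mem_ofPred_eq] at hg hg'
  rw [SetLike.mem_coe, Subgroup.mem_centralizer_singleton_iff]
  have hxi : x⁻¹ = x := (mul_eq_one_iff_eq_inv.mp hx).symm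
  have hgi : g⁻¹ = g := (mul_eq_one_iff_eq_inv.mp hg').symm
  have h : x * g = g * x := by
    rw [mul_eq_one_iff_eq_inv.mp hg, mul_inv_rev, hxi, hgi]
  change x * g * x = x * (x * g)
  rw [mul_assoc, h]

variable [Finite G]

theorem two_mul_numSqOne_le (x : G) :
    2 * numSqOne G ≤
      Nat.card G + ({g : G | g * g = 1} ∩ (x * ·) '' {g : G | g * g = 1}).ncard := by
  have h := Set.ncard_union_add_ncard_inter {g : G | g * g = 1} ((x * ·) '' {g : G | g * g = 1})
  rw [Set.ncard_image_of_injective _ (mul_right_injective x)] at h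
  have h' := Set.ncard_le_card ({g : G | g * g = 1} ∪ (x * ·) '' {g : G | g * g = 1})
  unfold numSqOne
  omega

theorem two_mul_numSqOne_le_centralizer {x : G} (hx : x * x = 1) :
    2 * numSqOne G ≤
      Nat.card G + ({g : G | g * g = 1} ∩ Subgroup.centralizer {x}).ncard :=
  (two_mul_numSqOne_le x).trans
    (Nat.add_le_add_left (Set.ncard_le_ncard (inter_image_mul_subset hx)) _)

theorem ncard_inter_le_card (s : Set G) (H : Subgroup G) : (s ∩ H).ncard ≤ Nat.card H :=
  Set.ncard_le_ncard Set.inter_subset_right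

theorem mul_self_eq_one_of_central (hG : Nat.card G < 2 * numSqOne G)
    (hc : ∀ x : G, x * x = 1 → ∀ g, g * x = x * g) (g : G) : g * g = 1 := by
  have h := two_mul_numSqOne_le g
  obtain ⟨_, hb, a, ha, rfl⟩ : ({g : G | g * g = 1} ∩ (g * ·) '' {g : G | g * g = 1}).Nonempty := by
    rw [← Set.ncard_pos]
    omega
  simp only [Set.mem_ofPred_eq] at ha hb
  rwa [mul_assoc, ← mul_assoc a, ← hc a ha, mul_assoc g a, ha, mul_one] at hb

theorem mul_self_eq_one_of_three_mul_card_lt (hG : 3 * Nat.card G < 4 * numSqOne G) (g : G) :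
    g * g = 1 := by
  refine mul_self_eq_one_of_central (by omega) (fun x hx g => ?_) g
  have h1 := two_mul_numSqOne_le_centralizer hx
  have h2 := ncard_inter_le_card {g : G | g * g = 1} (Subgroup.centralizer {x})
  have h3 := (Subgroup.centralizer {x}).card_mul_index
  have h4 : (Subgroup.centralizer {x}).index = 1 := by
    have h5 : (Subgroup.centralizer {x}).index ≠ 0 := Subgroup.index_ne_zero_of_finite
    by_contra h6
    have h7 : 2 ≤ (Subgroup.centralizer {x}).index := by omega
    have := Nat.mul_le_mul_left (Nat.card (Subgroup.centralizer {x})) h7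
    omega
  rw [← Subgroup.mem_centralizer_singleton_iff, Subgroup.index_eq_one.mp h4]
  trivial

theorem index_centralizer_le_three (hG : 2 * Nat.card G ≤ 3 * numSqOne G) {x : G}
    (hx : x * x = 1) : (Subgroup.centralizer {x}).index ≤ 3 := by
  have h1 := two_mul_numSqOne_le_centralizer hx
  have h2 := ncard_inter_le_card {g : G | g * g = 1} (Subgroup.centralizer {x})
  have h3 := (Subgroup.centralizer {x}).card_mul_index
  have h0 : 0 < Nat.card G := Nat.card_pos
  by_contra h6
  have h7 : 4 ≤ (Subgroup.centralizer {x}).index := by omega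
  have := Nat.mul_le_mul_left (Nat.card (Subgroup.centralizer {x})) h7
  omega

theorem mul_self_eq_one_of_mem_centralizer (hG : 2 * Nat.card G ≤ 3 * numSqOne G) {x : G}
    (hx : x * x = 1) (hind : (Subgroup.centralizer {x}).index = 3) {g : G}
    (hg : g ∈ Subgroup.centralizer {x}) : g * g = 1 := by
  have h1 := two_mul_numSqOne_le_centralizer hx
  have h3 := (Subgroup.centralizer {x}).card_mul_index
  rw [hind] at h3
  have h4 : {g : G | g * g = 1} ∩ Subgroup.centralizer {x} =
      (Subgroup.centralizer {x} : Set G) := by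
    refine Set.eq_of_subset_of_ncard_le Set.inter_subset_right ?_
    have : (Subgroup.centralizer {x} : Set G).ncard = Nat.card (Subgroup.centralizer {x}) := rfl
    omega
  exact (Set.inter_eq_right.mp h4) hg

theorem exists_mul_self_eq_one_notMem (hG : Nat.card G < 2 * numSqOne G) {H : Subgroup G}
    (hH : H ≠ ⊤) : ∃ y, y * y = 1 ∧ y ∉ H := by
  by_contra! h
  have h1 : numSqOne G ≤ Nat.card H := Set.ncard_le_ncard (t := (H : Set G)) h
  have h3 := H.card_mul_index
  have h4 : H.index ≠ 1 := fun h => hH (Subgroup.index_eq_one.mp h)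
  have h5 : H.index ≠ 0 := Subgroup.index_ne_zero_of_finite
  have := Nat.mul_le_mul_left (Nat.card H) (show 2 ≤ H.index by omega)
  omega

/-- In an elementary abelian 2-subgroup, a nontrivial cyclic subgroup has a complement. -/
theorem exists_le_index_two_complement {W : Subgroup G} (hW : ∀ w ∈ W, w * w = 1) {z : G}
    (hzW : z ∈ W) (hz : z ≠ 1) :
    ∃ V ≤ W, Nat.card W = 2 * Nat.card V ∧ ∀ w ∈ W, w ∈ V ∨ z * w ∈ V := by
  have hcomm : ∀ a ∈ W, ∀ b ∈ W, a * b = b * a := fun a ha b hb =>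
    congrArg Subtype.val
      (mul_comm_of_mul_self_eq_one (G := W) (fun g => Subtype.ext (hW g g.2)) ⟨a, ha⟩ ⟨b, hb⟩)
  obtain ⟨V, hV⟩ := (Set.toFinite {V : Subgroup G | V ≤ W ∧ z ∉ V}).exists_maximal
    ⟨⊥, bot_le, fun h => hz (Subgroup.mem_bot.mp h)⟩
  have hVW : V ≤ W := hV.prop.1
  have hzV : z ∉ V := hV.prop.2
  have key : ∀ w ∈ W, w ∈ V ∨ z * w ∈ V := by
    intro w hw
    by_contra! hn
    let U : Subgroup G :=
      { carrier := {g | g ∈ W ∧ (g ∈ V ∨ w * g ∈ V)}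
        one_mem' := ⟨one_mem _, Or.inl (one_mem _)⟩
        inv_mem' := by
          rintro g ⟨hgW, hg⟩
          rw [← mul_eq_one_iff_eq_inv.mp (hW g hgW)]
          exact ⟨hgW, hg⟩
        mul_mem' := fun {a b} ha hb => by
          refine ⟨mul_mem ha.1 hb.1, ?_⟩
          rcases ha.2 with h1 | h1 <;> rcases hb.2 with h2 | h2
          · exact Or.inl (mul_mem h1 h2)
          · right
            rw [← mul_assoc, hcomm w hw a ha.1, mul_assoc]
            exact mul_mem h1 h2
          · right
            rw [← mul_assoc]
            exact mul_mem h1 h2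
          · left
            have := mul_mem h1 h2
            rwa [hcomm w hw a ha.1, mul_assoc, ← mul_assoc w, hW w hw, one_mul] at this }
    have hVU : V ≤ U := fun v hv => ⟨hVW hv, Or.inl hv⟩
    have hwU : w ∈ U := ⟨hw, Or.inr (by rw [hW w hw]; exact one_mem _)⟩
    have hzU : z ∉ U := by
      rintro ⟨-, h | h⟩
      · exact hzV h
      · rw [hcomm w hw z hzW] at h
        exact hn.2 h
    have hUW : U ≤ W := fun g hg => And.left hg
    exact hn.1 (hV.le_of_ge ⟨hUW, hzU⟩ hVU hwU)
  refine ⟨V, hVW, ?_, key⟩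
  have hrel : V.relIndex W = 2 := by
    refine Subgroup.index_eq_two_iff.mpr ⟨⟨z, hzW⟩, fun b => ?_⟩
    simp only [Subgroup.mem_subgroupOf, Subgroup.coe_mul]
    rw [hcomm b b.2 z hzW]
    rcases key b b.2 with h | h
    · refine Or.inr ⟨h, fun h' => hzV ?_⟩
      exact (V.mul_mem_cancel_right h).mp h'
    · refine Or.inl ⟨h, fun h' => hzV ?_⟩
      exact (V.mul_mem_cancel_right h').mp h
  have h1 := Subgroup.relIndex_mul_index hVW
  have h2 := V.card_mul_index
  rw [← h1, hrel, ← W.card_mul_index, ← mul_assoc, mul_comm _ 2] at h2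
  exact (Nat.eq_of_mul_eq_mul_right (Nat.pos_of_ne_zero Subgroup.index_ne_zero_of_finite) h2).symm

end Involutions

section Classification

variable {G : Type*} [Group G]

theorem commute_right_of_commute_mul {x y z : G} (hx : Commute z x) (hxy : Commute z (x * y)) :
    Commute z y := by
  simpa using hx.inv_right.mul_right hxy

theorem mul_mul_mul_self {a w : G} (h : Commute w a) : a * w * (a * w) = a * a * (w * w) := by
  rw [mul_assoc, ← mul_assoc w, h.eq, mul_assoc, mul_assoc]

theorem pow_three_mem_of_mul_mem {C : Subgroup G} (hind : C.index = 3) {x y : G}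
    (hx : x * x = 1) (hy : y * y = 1) (hxC : x ∈ C) (hyC : y ∉ C) (hyxy : y * x * y ∉ C) :
    (x * y) ^ 3 ∈ C := by
  have hxi : x⁻¹ = x := (mul_eq_one_iff_eq_inv.mp hx).symm
  have hyi : y⁻¹ = y := (mul_eq_one_iff_eq_inv.mp hy).symm
  by_contra h
  have hn : y * (x * (y * (x * y))) ∉ C := fun h' => h (by
    have := mul_mem hxC h'
    simpa [pow_succ, mul_assoc] using this)
  have hxy : x * y ∉ C := fun h' => hyC ((C.mul_mem_cancel_left hxC).mp h')
  let f : Fin 4 → G := ![1, y, x * y, y * x * y]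
  have hf : Function.Injective fun i => (f i : G ⧸ C) := by
    have h01 : ((1 : G) : G ⧸ C) ≠ (y : G ⧸ C) := fun h' => hyC (by
      simpa using QuotientGroup.eq.mp h')
    have h02 : ((1 : G) : G ⧸ C) ≠ ((x * y : G) : G ⧸ C) := fun h' => hxy (by
      simpa using QuotientGroup.eq.mp h')
    have h03 : ((1 : G) : G ⧸ C) ≠ ((y * x * y : G) : G ⧸ C) := fun h' => hyxy (by
      simpa using QuotientGroup.eq.mp h')
    have h12 : (y : G ⧸ C) ≠ ((x * y : G) : G ⧸ C) := fun h' => hyxy (by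
      simpa [hyi, mul_assoc] using QuotientGroup.eq.mp h')
    have h13 : (y : G ⧸ C) ≠ ((y * x * y : G) : G ⧸ C) := fun h' => hxy (by
      simpa [mul_assoc] using QuotientGroup.eq.mp h')
    have h23 : ((x * y : G) : G ⧸ C) ≠ ((y * x * y : G) : G ⧸ C) := fun h' => hn (by
      simpa [hxi, hyi, mul_assoc] using QuotientGroup.eq.mp h')
    intro i j hij
    fin_cases i <;> fin_cases j <;> first
      | rfl
      | exact (h01 hij).elim
      | exact (h02 hij).elim
      | exact (h03 hij).elim
      | exact (h12 hij).elim
      | exact (h13 hij).elim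
      | exact (h23 hij).elim
      | exact (h01 hij.symm).elim
      | exact (h02 hij.symm).elim
      | exact (h03 hij.symm).elim
      | exact (h12 hij.symm).elim
      | exact (h13 hij.symm).elim
      | exact (h23 hij.symm).elim
  have : Finite (G ⧸ C) := Nat.finite_of_card_ne_zero (by
    rw [← Subgroup.index_eq_card, hind]; norm_num)
  have hle := Nat.card_le_card_of_injective _ hf
  rw [← Subgroup.index_eq_card, hind, Nat.card_eq_fintype_card, Fintype.card_fin] at hle
  omega

variable [Finite G]

theorem exists_mulEquiv_dihedral_three (hG : 2 * Nat.card G ≤ 3 * numSqOne G) {x : G}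
    (hx : x * x = 1) (hind : (Subgroup.centralizer {x}).index = 3) :
    ∃ m : ℕ, Nonempty (G ≃* (Fin m → Multiplicative (ZMod 2)) × DihedralGroup 3) := by
  have hpos : 0 < Nat.card G := Nat.card_pos
  obtain ⟨y, hy, hyC⟩ := exists_mul_self_eq_one_notMem (H := Subgroup.centralizer {x})
    (by omega) (fun h => by rw [h, Subgroup.index_top] at hind; omega)
  have hC : ∀ g ∈ Subgroup.centralizer {x}, g * g = 1 := fun g hg =>
    mul_self_eq_one_of_mem_centralizer hG hx hind hg
  have hxC : x ∈ Subgroup.centralizer {x} := Subgroup.mem_centralizer_singleton_iff.mpr rfl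
  have hxy : x ∉ Subgroup.centralizer {y} := fun h =>
    hyC (Subgroup.mem_centralizer_singleton_iff.mpr
      (Subgroup.mem_centralizer_singleton_iff.mp h).symm)
  have hrel : (Subgroup.centralizer {y}).relIndex (Subgroup.centralizer {x}) = 2 := by
    have h0 : (Subgroup.centralizer {y}).relIndex (Subgroup.centralizer {x}) ≠ 0 :=
      Subgroup.index_ne_zero_of_finite
    have h1 : (Subgroup.centralizer {y}).relIndex (Subgroup.centralizer {x}) ≠ 1 := fun h =>
      hxy (Subgroup.relIndex_eq_one.mp h hxC)
    have h2 : (Subgroup.centralizer {y}).relIndex (Subgroup.centralizer {x}) ≤ 3 := by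
      refine le_trans ?_ (index_centralizer_le_three hG hy)
      rw [← Subgroup.relIndex_top_right]
      refine Subgroup.relIndex_le_of_le_right le_top ?_
      rw [Subgroup.relIndex_top_right]
      exact Subgroup.index_ne_zero_of_finite
    have h3 : (Subgroup.centralizer {y}).relIndex (Subgroup.centralizer {x}) ≠ 3 := fun h => by
      have hd := Subgroup.relIndex_dvd_card (Subgroup.centralizer {y}) (Subgroup.centralizer {x})
      rw [h] at hd
      have : Fact (Nat.Prime 3) := ⟨Nat.prime_three⟩
      obtain ⟨g, hg⟩ := exists_prime_orderOf_dvd_card' 3 hd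
      have h4 : orderOf g ∣ 2 := orderOf_dvd_of_pow_eq_one (by
        rw [pow_two]; exact Subtype.ext (hC g g.2))
      rw [hg] at h4
      omega
    omega
  have hgen : ∀ R : Subgroup G, Subgroup.centralizer {x} ⊓ Subgroup.centralizer {y} ≤ R →
      x ∈ R → y ∈ R → R = ⊤ := fun R h1 h2 h3 =>
    eq_top_of_centralizer_inf_le Nat.prime_three hind hyC hrel h1 h2 h3
  have hyi : y⁻¹ = y := (mul_eq_one_iff_eq_inv.mp hy).symm
  have hyxy : y * x * y ∉ Subgroup.centralizer {x} := by
    intro h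
    have hconj : ∀ c ∈ Subgroup.centralizer {x}, y * c * y ∈ Subgroup.centralizer {x} := by
      intro c hc
      rcases mem_or_mul_mem_of_relIndex_eq_two hrel hxC hxy hc with h1 | h1
      · rw [← Subgroup.mem_centralizer_singleton_iff.mp h1, mul_assoc, hy, mul_one]
        exact hc
      · have h2 : y * c * y = y * x * y * (x * c) := by
          rw [mul_assoc (y * x), ← Subgroup.mem_centralizer_singleton_iff.mp h1, ← mul_assoc,
            ← mul_assoc, mul_assoc y x x, hx, mul_one]
        rw [h2]
        exact mul_mem h (mul_mem hxC hc)
    have hnorm : Subgroup.normalizer (Subgroup.centralizer {x} : Set G) = ⊤ := by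
      refine hgen _ (inf_le_left.trans Subgroup.le_normalizer) (Subgroup.le_normalizer hxC) ?_
      rw [Subgroup.mem_normalizer_iff]
      intro g
      rw [hyi]
      refine ⟨hconj g, fun hg => ?_⟩
      have := hconj _ hg
      rwa [← mul_assoc, ← mul_assoc, hy, one_mul, mul_assoc, hy, mul_one] at this
    have := Subgroup.normalizer_eq_top_iff.mp hnorm
    have h3 := Subgroup.pow_index_mem (Subgroup.centralizer {x}) y
    rw [hind, pow_succ, pow_two, hy, one_mul] at h3
    exact hyC h3
  have hkC := pow_three_mem_of_mul_mem hind hx hy hxC hyC hyxy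
  have hkx : Commute ((x * y) ^ 3) x := Subgroup.mem_centralizer_singleton_iff.mp hkC
  have hky : Commute ((x * y) ^ 3) y :=
    commute_right_of_commute_mul hkx ((Commute.refl _).pow_left 3)
  have hk := hC _ hkC
  set k := (x * y) ^ 3 with hkdef
  have hkW : k ∈ Subgroup.centralizer {x} ⊓ Subgroup.centralizer {y} :=
    ⟨hkC, Subgroup.mem_centralizer_singleton_iff.mpr hky⟩
  refine exists_mulEquiv_pi_prod_dihedral (x := x) (y := y * k)
    (Subgroup.centralizer {x} ⊓ Subgroup.centralizer {y}) (fun v hv => hC v hv.1)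
    (fun v hv => Subgroup.mem_centralizer_singleton_iff.mp hv.1)
    (fun v hv => ?_) hx ?_ ?_ (card_eq_card_centralizer_inf_mul hind hrel)
    (fun R h1 h2 h3 => hgen R h1 h2 ((R.mul_mem_cancel_right (h1 hkW)).mp h3))
  · have h1 : Commute v y := Subgroup.mem_centralizer_singleton_iff.mp hv.2
    have h2 : Commute v (x * y) :=
      Commute.mul_right (Subgroup.mem_centralizer_singleton_iff.mp hv.1) h1
    exact h1.mul_right (h2.pow_right 3)
  · rw [mul_mul_mul_self hky, hy, hk, one_mul]
  · have h1 : Commute (x * y) k := (Commute.refl _).pow_right 3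
    rw [← mul_assoc, h1.mul_pow, ← hkdef, ← pow_succ', show 3 + 1 = 2 * 2 from rfl, pow_mul,
      pow_two k, hk, one_pow]

theorem mul_self_eq_one_of_mem_inf (hG : 2 * Nat.card G ≤ 3 * numSqOne G) {x y : G}
    (hx : x * x = 1) (hy : y * y = 1) (hyC : y ∉ Subgroup.centralizer {x})
    (hind : (Subgroup.centralizer {x}).index = 2)
    (hrel : (Subgroup.centralizer {y}).relIndex (Subgroup.centralizer {x}) = 2) {w : G}
    (hw : w ∈ Subgroup.centralizer {x} ⊓ Subgroup.centralizer {y}) : w * w = 1 := by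
  have hxC : x ∈ Subgroup.centralizer {x} := Subgroup.mem_centralizer_singleton_iff.mpr rfl
  have hxy : x ∉ Subgroup.centralizer {y} := fun h =>
    hyC (Subgroup.mem_centralizer_singleton_iff.mpr
      (Subgroup.mem_centralizer_singleton_iff.mp h).symm)
  have hcard := card_eq_card_centralizer_inf_mul hind hrel
  have hWx : ∀ w ∈ Subgroup.centralizer {x} ⊓ Subgroup.centralizer {y}, Commute w x :=
    fun w hw => Subgroup.mem_centralizer_singleton_iff.mp hw.1
  have hWy : ∀ w ∈ Subgroup.centralizer {x} ⊓ Subgroup.centralizer {y}, Commute w y :=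
    fun w hw => Subgroup.mem_centralizer_singleton_iff.mp hw.2
  have hmem : ∀ g ∈ Subgroup.centralizer {x},
      g ∈ Subgroup.centralizer {x} ⊓ Subgroup.centralizer {y} ∨
        x * g ∈ Subgroup.centralizer {x} ⊓ Subgroup.centralizer {y} := fun g hg =>
    (mem_or_mul_mem_of_relIndex_eq_two hrel hxC hxy hg).imp (fun h => ⟨hg, h⟩)
      (fun h => ⟨mul_mem hxC hg, h⟩)
  have hcover : ∀ g : G, g ∈ Subgroup.centralizer {x} ∨ y * g ∈ Subgroup.centralizer {x} := by
    intro g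
    rw [Subgroup.mul_mem_iff_of_index_two hind]
    tauto
  set W := Subgroup.centralizer {x} ⊓ Subgroup.centralizer {y}
  have hnW : numSqOne W = ({g : G | g * g = 1} ∩ W).ncard := by
    unfold numSqOne
    rw [← Set.ncard_image_of_injective _ W.subtype_injective]
    congr 1
    ext g
    simp [Subtype.ext_iff]
  have hdiff : ((W : Set G) \ {g : G | g * g = 1}).ncard + numSqOne W = Nat.card W := by
    rw [hnW, Set.inter_comm]
    have := Set.ncard_inter_add_ncard_sdiff_eq_ncard (W : Set G) {g : G | g * g = 1}
    have h2 : (W : Set G).ncard = Nat.card W := rfl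
    omega
  have hsub : {g : G | g * g = 1} ⊆
      (({g : G | g * g = 1} ∩ W) ∪ (x * ·) '' ({g : G | g * g = 1} ∩ W)) ∪
      ((y * ·) '' ({g : G | g * g = 1} ∩ W) ∪
        (y * x * ·) '' ((W : Set G) \ {g : G | g * g = 1})) := by
    intro g hg
    simp only [Set.mem_ofPred_eq] at hg
    have hsq : ∀ a v : G, a * a = 1 → Commute v a → a * v * (a * v) = 1 → v * v = 1 :=
      fun a v ha hv h => by rwa [mul_mul_mul_self hv, ha, one_mul] at h
    rcases hcover g with h | h <;> rcases hmem _ h with h' | h'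
    · exact Or.inl (Or.inl ⟨hg, h'⟩)
    · have hgx : g = x * (x * g) := by rw [← mul_assoc, hx, one_mul]
      refine Or.inl (Or.inr ⟨x * g, ⟨?_, h'⟩, hgx.symm⟩)
      exact hsq x _ hx (hWx _ h') (by rwa [← hgx])
    · have hgy : g = y * (y * g) := by rw [← mul_assoc, hy, one_mul]
      refine Or.inr (Or.inl ⟨y * g, ⟨?_, h'⟩, hgy.symm⟩)
      exact hsq y _ hy (hWy _ h') (by rwa [← hgy])
    · have hgyx : g = y * x * (x * (y * g)) := by
        rw [mul_assoc y, ← mul_assoc x x, hx, one_mul, ← mul_assoc, hy, one_mul]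
      refine Or.inr (Or.inr ⟨x * (y * g), ⟨h', fun h1 => hyC ?_⟩, hgyx.symm⟩)
      simp only [Set.mem_ofPred_eq] at h1
      rw [hgyx, mul_mul_mul_self ((hWy _ h').mul_right (hWx _ h')), h1, mul_one] at hg
      rw [Subgroup.mem_centralizer_singleton_iff, mul_eq_one_iff_eq_inv.mp hg, mul_inv_rev,
        ← mul_eq_one_iff_eq_inv.mp hx, ← mul_eq_one_iff_eq_inv.mp hy]
  have hle := Set.ncard_le_ncard hsub
  have hle1 := Set.ncard_union_le
    (({g : G | g * g = 1} ∩ W) ∪ (x * ·) '' ({g : G | g * g = 1} ∩ W))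
    ((y * ·) '' ({g : G | g * g = 1} ∩ W) ∪
        (y * x * ·) '' ((W : Set G) \ {g : G | g * g = 1}))
  have hle2 := Set.ncard_union_le ({g : G | g * g = 1} ∩ W) ((x * ·) '' ({g : G | g * g = 1} ∩ W))
  have hle3 := Set.ncard_union_le ((y * ·) '' ({g : G | g * g = 1} ∩ W))
        ((y * x * ·) '' ((W : Set G) \ {g : G | g * g = 1}))
  rw [Set.ncard_image_of_injective _ (mul_right_injective _)] at hle2 hle3
  rw [Set.ncard_image_of_injective _ (mul_right_injective _)] at hle3
  rw [← hnW] at hle2 hle3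
  have hWpos : 0 < Nat.card W := Nat.card_pos
  have hfin : 3 * Nat.card W < 4 * numSqOne W := by
    change numSqOne G ≤ _ at hle
    omega
  exact congrArg Subtype.val (mul_self_eq_one_of_three_mul_card_lt hfin ⟨w, hw⟩)

theorem exists_mulEquiv_dihedral_four (hG : 2 * Nat.card G ≤ 3 * numSqOne G)
    (hall : ∀ x : G, x * x = 1 → (Subgroup.centralizer {x}).index ≠ 3) {x : G}
    (hx : x * x = 1) (hx1 : (Subgroup.centralizer {x}).index ≠ 1) :
    ∃ m : ℕ, Nonempty (G ≃* (Fin m → Multiplicative (ZMod 2)) × DihedralGroup 4) := by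
  have hpos : 0 < Nat.card G := Nat.card_pos
  have htwo : ∀ x : G, x * x = 1 → (Subgroup.centralizer {x}).index ≠ 1 →
      (Subgroup.centralizer {x}).index = 2 := fun x hx h1 => by
    have h0 : (Subgroup.centralizer {x}).index ≠ 0 := Subgroup.index_ne_zero_of_finite
    have h3 := hall x hx
    have := index_centralizer_le_three hG hx
    omega
  have hind := htwo x hx hx1
  obtain ⟨y, hy, hyC⟩ := exists_mul_self_eq_one_notMem (H := Subgroup.centralizer {x})
    (by omega) (fun h => by rw [h, Subgroup.index_top] at hind; omega)
  have hxC : x ∈ Subgroup.centralizer {x} := Subgroup.mem_centralizer_singleton_iff.mpr rfl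
  have hxy : x ∉ Subgroup.centralizer {y} := fun h =>
    hyC (Subgroup.mem_centralizer_singleton_iff.mpr
      (Subgroup.mem_centralizer_singleton_iff.mp h).symm)
  have hindy := htwo y hy fun h => hxy (Subgroup.index_eq_one.mp h ▸ Subgroup.mem_top x)
  have hrel : (Subgroup.centralizer {y}).relIndex (Subgroup.centralizer {x}) = 2 := by
    have : (Subgroup.centralizer {y}).Normal := Subgroup.normal_of_index_eq_two hindy
    have h := Subgroup.relIndex_dvd_index_of_normal (Subgroup.centralizer {y})
      (Subgroup.centralizer {x})
    rw [hindy] at h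
    refine ((Nat.dvd_prime Nat.prime_two).mp h).resolve_left fun h1 => ?_
    exact hxy (Subgroup.relIndex_eq_one.mp h1 hxC)
  have hW : ∀ w ∈ Subgroup.centralizer {x} ⊓ Subgroup.centralizer {y}, w * w = 1 := fun w hw =>
    mul_self_eq_one_of_mem_inf hG hx hy hyC hind hrel hw
  have hzC : (x * y) ^ 2 ∈ Subgroup.centralizer {x} := Subgroup.sq_mem_of_index_two hind _
  have hzx : Commute ((x * y) ^ 2) x := Subgroup.mem_centralizer_singleton_iff.mp hzC
  have hzy : Commute ((x * y) ^ 2) y :=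
    commute_right_of_commute_mul hzx ((Commute.refl _).pow_left 2)
  have hzW : (x * y) ^ 2 ∈ Subgroup.centralizer {x} ⊓ Subgroup.centralizer {y} :=
    ⟨hzC, Subgroup.mem_centralizer_singleton_iff.mpr hzy⟩
  have hz1 : (x * y) ^ 2 ≠ 1 := fun h => hyC (by
    rw [pow_two] at h
    rw [Subgroup.mem_centralizer_singleton_iff, mul_eq_one_iff_eq_inv.mp h, mul_inv_rev,
      ← mul_eq_one_iff_eq_inv.mp hx, ← mul_eq_one_iff_eq_inv.mp hy])
  obtain ⟨V, hVW, hVcard, hV⟩ := exists_le_index_two_complement hW hzW hz1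
  refine exists_mulEquiv_pi_prod_dihedral (x := x) (y := y) V (fun v hv => hW v (hVW hv))
    (fun v hv => Subgroup.mem_centralizer_singleton_iff.mp (hVW hv).1)
    (fun v hv => Subgroup.mem_centralizer_singleton_iff.mp (hVW hv).2) hx hy ?_ ?_
    (fun R hVR hxR hyR => ?_)
  · rw [show 4 = 2 * 2 from rfl, pow_mul, pow_two ((x * y) ^ 2)]
    exact hW _ hzW
  · rw [card_eq_card_centralizer_inf_mul hind hrel, hVcard]
    ring
  · refine eq_top_of_centralizer_inf_le Nat.prime_two hind hyC hrel (fun w hw => ?_) hxR hyR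
    rcases hV w hw with h | h
    · exact hVR h
    · exact (R.mul_mem_cancel_left (pow_mem (mul_mem hxR hyR) 2)).mp (hVR h)

end Classification

theorem two_mul_card_le_of_alpha {G : Type*} [Group G] [Fintype G] (h : alpha G ≥ 5 / 6) :
    2 * Nat.card G ≤ 3 * numSqOne G := by
  have hG : (0 : ℚ) < Nat.card G := by exact_mod_cast Nat.card_pos
  have h' : (2 : ℚ) * numCyclic G ≤ Nat.card G + numSqOne G := by
    exact_mod_cast two_mul_numCyclic_le G
  unfold alpha at h
  rw [ge_iff_le, le_div_iff₀ hG] at h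
  have : (2 : ℚ) * Nat.card G ≤ 3 * numSqOne G := by linarith
  exact_mod_cast this

theorem stmt_15 (G : Type*) [Group G] [Fintype G] (h : alpha G ≥ 5 / 6) :
    ((∃ n : ℕ, Nonempty (G ≃* (Fin n → Multiplicative (ZMod 2)) × Equiv.Perm (Fin 3)))
        ∧ alpha G = 5 / 6) ∨
    ((∃ n : ℕ, Nonempty (G ≃* (Fin n → Multiplicative (ZMod 2)) × DihedralGroup 4))
        ∧ alpha G = 7 / 8) ∨
    ((∃ n : ℕ, Nonempty (G ≃* (Fin n → Multiplicative (ZMod 2))))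
        ∧ alpha G = 1) := by
  have hG := two_mul_card_le_of_alpha h
  have hpos : 0 < Nat.card G := Nat.card_pos
  by_cases h3 : ∃ x : G, x * x = 1 ∧ (Subgroup.centralizer {x}).index = 3
  · obtain ⟨x, hx, hind⟩ := h3
    obtain ⟨n, ⟨e⟩⟩ := exists_mulEquiv_dihedral_three hG hx hind
    obtain ⟨e'⟩ := nonempty_dihedral_three_mulEquiv_perm
    exact Or.inl ⟨⟨n, ⟨e.trans ((MulEquiv.refl _).prodCongr e')⟩⟩,
      le_antisymm (alpha_le_of_mulEquiv_dihedral_three e) h⟩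
  push Not at h3
  by_cases h1 : ∃ x : G, x * x = 1 ∧ (Subgroup.centralizer {x}).index ≠ 1
  · obtain ⟨x, hx, hind⟩ := h1
    obtain ⟨n, ⟨e⟩⟩ := exists_mulEquiv_dihedral_four hG h3 hx hind
    exact Or.inr (Or.inl ⟨⟨n, ⟨e⟩⟩, alpha_of_mulEquiv_dihedral_four e⟩)
  push Not at h1
  have hsq : ∀ g : G, g * g = 1 :=
    mul_self_eq_one_of_central (by omega) fun x hx g =>
      Subgroup.mem_centralizer_singleton_iff.mp
        (Subgroup.index_eq_one.mp (h1 x hx) ▸ Subgroup.mem_top g)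
  exact Or.inr (Or.inr ⟨exists_mulEquiv_pi_of_mul_self_eq_one hsq, alpha_of_forall_mul_self hsq⟩)
end

section
/- Let p ≥ 3 be a prime and let G be a non-trivial finite group all of whose prime divisors are at least p. Then α(G) ≤ 2/p, with equality if and only if G is cyclic of order p. -/
open scoped Classical

lemma coprime_of_lt_of_prime_le {n p k : ℕ} (hdiv : ∀ q : ℕ, q.Prime → q ∣ n → p ≤ q)
    (hk : 0 < k) (hkp : k < p) : n.Coprime k :=
  Nat.coprime_of_dvd fun q hq hqn hqk =>
    absurd (Nat.le_of_dvd hk hqk) (not_le.mpr (hkp.trans_le (hdiv q hq hqn)))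

lemma le_of_dvd_of_prime_le {n p m : ℕ} (hdiv : ∀ q : ℕ, q.Prime → q ∣ n → p ≤ q)
    (hm : m ∣ n) (hm0 : 0 < m) (hm1 : m ≠ 1) : p ≤ m :=
  (hdiv _ (Nat.minFac_prime hm1) ((Nat.minFac_dvd m).trans hm)).trans (Nat.minFac_le hm0)

lemma zpowers_pow_of_coprime {G : Type*} [Group G] {g : G} {k : ℕ}
    (h : (orderOf g).Coprime k) : Subgroup.zpowers (g ^ k) = Subgroup.zpowers g := by
  refine le_antisymm (Subgroup.zpowers_le.mpr (Subgroup.npow_mem_zpowers g k)) ?_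
  obtain ⟨m, hm⟩ := exists_pow_eq_self_of_coprime h.symm
  refine Subgroup.zpowers_le.mpr ?_
  have hmem := Subgroup.npow_mem_zpowers (g ^ k) m
  rwa [hm] at hmem

/-- Each nontrivial cyclic subgroup has at least `p - 1` generators. -/
lemma numCyclic_mul_le {G : Type*} [Group G] [Finite G] {p : ℕ}
    (hdiv : ∀ q : ℕ, q.Prime → q ∣ Nat.card G → p ≤ q) :
    (numCyclic G - 1) * (p - 1) ≤ Nat.card G - 1 := by
  let S : Set (Subgroup G) := {H | IsCyclic H}
  have hS : numCyclic G - 1 = (S \ {⊥}).ncard := by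
    have hbot : (⊥ : Subgroup G) ∈ S := inferInstanceAs (IsCyclic (⊥ : Subgroup G))
    rw [Set.ncard_sdiff_singleton_of_mem hbot]
    rfl
  have hG : Nat.card G - 1 = (Set.univ \ {(1 : G)}).ncard := by
    rw [Set.ncard_sdiff_singleton_of_mem (Set.mem_univ _), Set.ncard_univ]
  have hp : p - 1 = (Set.Ioo 0 p).ncard := by
    rw [← Finset.coe_Ioo, Set.ncard_coe_finset, Nat.card_Ioo]
    rfl
  have hgen : ∀ H : Subgroup G, ∃ g : G, H ∈ S → Subgroup.zpowers g = H := fun H => by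
    by_cases h : H ∈ S
    · obtain ⟨g, hg⟩ := (Subgroup.isCyclic_iff_exists_zpowers_eq_top H).mp h
      exact ⟨g, fun _ => hg⟩
    · exact ⟨1, fun h' => absurd h' h⟩
  choose gen hgen using hgen
  have hpow : ∀ x ∈ (S \ {⊥}) ×ˢ Set.Ioo 0 p, Subgroup.zpowers (gen x.1 ^ x.2) = x.1 := by
    rintro ⟨H, k⟩ ⟨⟨hH, -⟩, hk0, hkp⟩
    rw [zpowers_pow_of_coprime, hgen H hH]
    exact (coprime_of_lt_of_prime_le hdiv hk0 hkp).coprime_dvd_left (orderOf_dvd_natCard _)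
  rw [hS, hG, hp, ← Set.ncard_prod]
  refine Set.ncard_le_ncard_of_injOn (fun x => gen x.1 ^ x.2) ?_ ?_
  · intro x hx
    refine ⟨Set.mem_univ _, fun h => hx.1.2 ?_⟩
    rw [Set.mem_singleton_iff, ← hpow x hx, Subgroup.zpowers_eq_bot]
    exact h
  · intro x hx y hy hxy
    have h1 : x.1 = y.1 := by
      rw [← hpow x hx, ← hpow y hy]
      exact congrArg Subgroup.zpowers hxy
    have hle : p ≤ orderOf (gen x.1) := by
      refine le_of_dvd_of_prime_le hdiv (orderOf_dvd_natCard _) (orderOf_pos _) fun h => hx.1.2 ?_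
      rw [orderOf_eq_one_iff] at h
      rw [Set.mem_singleton_iff, ← hgen x.1 hx.1.1, Subgroup.zpowers_eq_bot, h]
    refine Prod.ext h1 (pow_injOn_Iio_orderOf (x := gen x.1) (hx.2.2.trans_le hle)
      (hy.2.2.trans_le hle) ?_)
    dsimp only at hxy ⊢
    rw [hxy, h1]

lemma two_le_numCyclic {G : Type*} [Group G] [Finite G] [Nontrivial G] [IsCyclic G] :
    2 ≤ numCyclic G := by
  have : Nontrivial {H : Subgroup G // IsCyclic H} :=
    ⟨⟨⊥, inferInstance⟩, ⟨⊤, inferInstance⟩, fun h => bot_ne_top (congrArg Subtype.val h)⟩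
  exact Finite.one_lt_card

theorem stmt_17 (G : Type*) [Group G] [Fintype G] (p : ℕ) (hp : p.Prime)
    (hp3 : 3 ≤ p) (hG : Nontrivial G)
    (hdiv : ∀ q : ℕ, q.Prime → q ∣ Nat.card G → p ≤ q) :
    alpha G ≤ 2 / p ∧
      (alpha G = 2 / p ↔ IsCyclic G ∧ Nat.card G = p) := by
  set n := Nat.card G with hn
  set c := numCyclic G with hc
  have hn1 : 1 < n := Finite.one_lt_card
  have hpn : p ≤ n := le_of_dvd_of_prime_le hdiv dvd_rfl (by omega) (by omega)
  have hmain : ((c : ℚ) - 1) * (p - 1) ≤ n - 1 := by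
    have hc1 : 1 ≤ c := by
      have : Nonempty {H : Subgroup G // IsCyclic H} := ⟨⟨⊥, inferInstance⟩⟩
      exact Nat.card_pos
    have h := numCyclic_mul_le hdiv
    rw [← hc, ← hn] at h
    have h' : (((c - 1) * (p - 1) : ℕ) : ℚ) ≤ ((n - 1 : ℕ) : ℚ) := by exact_mod_cast h
    rwa [Nat.cast_mul, Nat.cast_pred hc1, Nat.cast_pred hp.pos, Nat.cast_pred (by omega)] at h'
  have hp3' : (3 : ℚ) ≤ p := by exact_mod_cast hp3
  have hpn' : (p : ℚ) ≤ n := by exact_mod_cast hpn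
  have hn0 : (0 : ℚ) < n := by linarith
  have hp0 : (0 : ℚ) < p := by linarith
  have halpha : alpha G = c / n := rfl
  have hbound : ((2 : ℚ) * n - c * p) * (p - 1) ≥ (n - p) * (p - 2) := by
    nlinarith [mul_le_mul_of_nonneg_right hmain hp0.le]
  have hle : alpha G ≤ 2 / p := by
    rw [halpha, div_le_div_iff₀ hn0 hp0]
    nlinarith [mul_nonneg (sub_nonneg.mpr hpn') (by linarith : (0 : ℚ) ≤ p - 2)]
  refine ⟨hle, fun h => ?_, fun ⟨_, hcard⟩ => le_antisymm hle ?_⟩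
  · rw [halpha, div_eq_div_iff hn0.ne' hp0.ne'] at h
    have hnp : n = p := by
      refine le_antisymm ?_ hpn
      have : (n : ℚ) ≤ p := by
        rw [h] at hbound
        nlinarith
      exact_mod_cast this
    have := Fact.mk hp
    exact ⟨isCyclic_of_prime_card hnp, hnp⟩
  · have h2 : (2 : ℚ) ≤ c := by exact_mod_cast two_le_numCyclic (G := G)
    rw [halpha, hcard]
    gcongr
end

section
/- Let p be an odd prime and let G be a finite group having the cyclic group C_p as an epimorphic image (equivalently, p divides |G/G'| where G' is the derived subgroup). Then α(G) ≤ 2/p. -/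
open scoped Classical

theorem card_cyclic_subgroups_le_card {G : Type*} [Group G] [Fintype G] (N : Subgroup G) :
    (Finset.univ.filter fun H : Subgroup G => IsCyclic H ∧ H ≤ N).card ≤ Nat.card N := by
  rw [Nat.card_eq_fintype_card, Fintype.card_subtype]
  refine (Finset.card_le_card ?_).trans
    (Finset.card_image_le (f := fun x : G => Subgroup.zpowers x))
  intro H hH
  obtain ⟨hc, hN⟩ := (Finset.mem_filter.1 hH).2
  obtain ⟨g, rfl⟩ := (Subgroup.isCyclic_iff_exists_zpowers_eq_top H).1 hc
  exact Finset.mem_image.2 ⟨g, by simpa using hN, rfl⟩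

theorem card_generators_of_isCyclic {G : Type*} [Group G] [Fintype G] (H : Subgroup G)
    (hH : IsCyclic H) :
    (Finset.univ.filter fun x : G => Subgroup.zpowers x = H).card = (Nat.card H).totient := by
  rw [Nat.card_eq_fintype_card, ← IsCyclic.card_orderOf_eq_totient (α := H) dvd_rfl,
    ← Finset.card_map (Function.Embedding.subtype (· ∈ H))]
  congr 1
  ext x
  simp only [Finset.mem_filter, Finset.mem_univ, true_and, Finset.mem_map,
    Function.Embedding.subtype_apply]
  constructor
  · rintro rfl
    exact ⟨⟨x, Subgroup.mem_zpowers x⟩, by simp [← Nat.card_eq_fintype_card, Nat.card_zpowers], rfl⟩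
  · rintro ⟨y, hy, rfl⟩
    refine Subgroup.eq_of_le_of_card_ge (by simp) ?_
    rw [Nat.card_zpowers, Subgroup.orderOf_coe, hy, Nat.card_eq_fintype_card]

theorem sub_one_mul_card_cyclic_not_le {G : Type*} [Group G] [Fintype G] {p : ℕ} (hp : p.Prime)
    (N : Subgroup G) [N.Normal] (hN : N.index = p) :
    (p - 1) * (Finset.univ.filter fun H : Subgroup G => IsCyclic H ∧ ¬ H ≤ N).card ≤
      (Finset.univ.filter fun x : G => x ∉ N).card := by
  rw [Finset.card_eq_sum_card_fiberwise (f := fun x : G => Subgroup.zpowers x)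
    (t := Finset.univ.filter fun H : Subgroup G => IsCyclic H ∧ ¬ H ≤ N)]
  · rw [mul_comm, ← smul_eq_mul]
    refine Finset.card_nsmul_le_sum _ _ _ fun H hH => ?_
    obtain ⟨hc, hHN⟩ := (Finset.mem_filter.1 hH).2
    have hdvd : p ∣ Nat.card H := by
      have h1 : N.relIndex H ∣ p := hN ▸ Subgroup.relIndex_dvd_index_of_normal N H
      have h2 : N.relIndex H ≠ 1 := fun h => hHN (Subgroup.relIndex_eq_one.1 h)
      rw [← ((Nat.dvd_prime hp).1 h1).resolve_left h2]
      exact Subgroup.relIndex_dvd_card N H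
    have hle : p - 1 ≤ (Nat.card H).totient := by
      rw [← Nat.totient_prime hp]
      exact Nat.le_of_dvd (Nat.totient_pos.2 Nat.card_pos) (Nat.totient_dvd_of_dvd hdvd)
    rw [← card_generators_of_isCyclic H hc] at hle
    refine hle.trans (Finset.card_le_card fun x hx => ?_)
    obtain rfl := (Finset.mem_filter.1 hx).2
    simpa using hHN
  · intro x hx
    simp only [Finset.coe_filter, Finset.mem_univ, true_and, Set.mem_ofPred_eq] at hx ⊢
    exact ⟨inferInstance, by simpa using hx⟩

theorem stmt_18 (G : Type*) [Group G] [Fintype G] (p : ℕ) (hp : p.Prime)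
    (hodd : Odd p)
    (hsurj : ∃ f : G →* Multiplicative (ZMod p), Function.Surjective f) :
    alpha G ≤ 2 / p := by
  obtain ⟨f, hf⟩ := hsurj
  have hidx : f.ker.index = p := by
    rw [Subgroup.index_ker, MonoidHom.range_eq_top.2 hf, Subgroup.card_top]
    exact Nat.card_zmod p
  have hcard : Nat.card f.ker * p = Nat.card G := by
    simpa only [hidx] using f.ker.card_mul_index
  have hin := card_cyclic_subgroups_le_card f.ker
  have hout := sub_one_mul_card_cyclic_not_le hp f.ker hidx
  have hcompl : (Finset.univ.filter fun x : G => x ∉ f.ker).card = (p - 1) * Nat.card f.ker := by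
    have h := Finset.card_filter_add_card_filter_not (s := (Finset.univ : Finset G))
      (fun x => x ∈ f.ker)
    rw [← Fintype.card_subtype, ← Nat.card_eq_fintype_card, Finset.card_univ,
      ← Nat.card_eq_fintype_card, ← hcard] at h
    rw [Nat.sub_mul, one_mul, mul_comm p]
    exact Nat.eq_sub_of_add_eq' h
  replace hout := Nat.le_of_mul_le_mul_left (hout.trans_eq (by convert hcompl)) (Nat.sub_pos_of_lt hp.one_lt)
  have hsum : numCyclic G ≤ 2 * Nat.card f.ker := by
    have h := Finset.card_filter_add_card_filter_not
      (s := Finset.univ.filter fun H : Subgroup G => IsCyclic H) (fun H => H ≤ f.ker)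
    rw [Finset.filter_filter, Finset.filter_filter] at h
    rw [numCyclic, Nat.card_eq_fintype_card, Fintype.card_subtype]
    omega
  have hp0 : (0 : ℚ) < p := by exact_mod_cast hp.pos
  have hG : (0 : ℚ) < Nat.card G := by exact_mod_cast Nat.card_pos
  rw [alpha, div_le_div_iff₀ hG hp0, ← hcard]
  have : (numCyclic G : ℚ) ≤ 2 * Nat.card f.ker := by exact_mod_cast hsum
  push_cast
  nlinarith
end
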